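/- Let g : ℝ^d → ℝ be convex and let λ, γ > 0. Then for every x ∈ ℝ^d, prox_{γ g^λ}(x) = (γ · prox_{(γ+λ) g}(x) + λ · x) / (γ + λ), where g^λ denotes the Moreau envelope of g (which is itself a real-valued convex function, so its proximal operator is well defined). -/

import Mathlib

open scoped RealInnerProductSpace

/-- If `p` minimizes `y ↦ g y + ‖x - y‖² / (2 t)` for a convex `g`, then `t⁻¹ • (x - p)` is a
subgradient of `g` at `p`. -/
theorem ConvexOn.inner_le_sub_of_isMinOn_prox {E : Type*} [NormedAddCommGroup E]
    [InnerProductSpace ℝ E] {g : E → ℝ} (hg : ConvexOn ℝ Set.univ g) {t : ℝ} (ht : 0 < t)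
    {x p : E} (hp : IsMinOn (fun y => g y + ‖x - y‖ ^ 2 / (2 * t)) Set.univ p) (y : E) :
    ⟪t⁻¹ • (x - p), y - p⟫ ≤ g y - g p := by
  rw [real_inner_smul_left]
  have key : ∀ r : ℝ, 0 < r → r ≤ 1 →
      t⁻¹ * ⟪x - p, y - p⟫ - (g y - g p) ≤ r * (‖y - p‖ ^ 2 / (2 * t)) := by
    intro r hr hr1
    have hmin : g p + ‖x - p‖ ^ 2 / (2 * t) ≤
        g ((1 - r) • p + r • y) + ‖x - ((1 - r) • p + r • y)‖ ^ 2 / (2 * t) :=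
      hp (Set.mem_univ _)
    have hconv : g ((1 - r) • p + r • y) ≤ (1 - r) * g p + r * g y :=
      hg.2 (Set.mem_univ p) (Set.mem_univ y) (sub_nonneg.2 hr1) hr.le (by ring)
    have hsub : x - ((1 - r) • p + r • y) = (x - p) - r • (y - p) := by module
    have hnorm : ‖x - ((1 - r) • p + r • y)‖ ^ 2 / (2 * t) = ‖x - p‖ ^ 2 / (2 * t)
        - r * (t⁻¹ * ⟪x - p, y - p⟫) + r * (r * (‖y - p‖ ^ 2 / (2 * t))) := by
      rw [hsub, norm_sub_sq_real, real_inner_smul_right, norm_smul, mul_pow, Real.norm_eq_abs,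
        sq_abs]
      field_simp
    refine le_of_mul_le_mul_left ?_ hr
    linarith
  have hlim : Filter.Tendsto (fun r : ℝ => r * (‖y - p‖ ^ 2 / (2 * t)))
      (nhdsWithin 0 (Set.Ioi 0)) (nhds 0) := by
    have h : Continuous fun r : ℝ => r * (‖y - p‖ ^ 2 / (2 * t)) := by fun_prop
    simpa using (h.tendsto 0).mono_left nhdsWithin_le_nhds
  have hle := ge_of_tendsto hlim (b := t⁻¹ * ⟪x - p, y - p⟫ - (g y - g p)) (by
    filter_upwards [Ioc_mem_nhdsGT (zero_lt_one' ℝ)] with r hr using key r hr.1 hr.2)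
  linarith

/-- A linear form plus a scaled squared norm is bounded below by completing the square. -/
theorem neg_mul_sq_norm_le_inner_add_sq_norm_div {E : Type*} [NormedAddCommGroup E]
    [InnerProductSpace ℝ E] {t : ℝ} (ht : 0 < t) (v w : E) :
    -(t * ‖v‖ ^ 2 / 2) ≤ ⟪v, w⟫ + ‖w‖ ^ 2 / (2 * t) := by
  have h : ⟪v, w⟫ + ‖w‖ ^ 2 / (2 * t) + t * ‖v‖ ^ 2 / 2 = ‖w + t • v‖ ^ 2 / (2 * t) := by
    rw [norm_add_sq_real, real_inner_smul_right, norm_smul, mul_pow, Real.norm_eq_abs, sq_abs,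
      real_inner_comm]
    field_simp
    ring
  have : 0 ≤ ‖w + t • v‖ ^ 2 / (2 * t) := by positivity
  linarith

/-- For a convex function `g : ℝ^d → ℝ` and `λ, γ > 0`, the proximal
operator of the Moreau envelope `g^λ` satisfies
`prox_{γ g^λ}(x) = (γ · prox_{(γ+λ) g}(x) + λ · x) / (γ + λ)`. -/
theorem prox_moreau_envelope {d : ℕ}
    (g : EuclideanSpace ℝ (Fin d) → ℝ)
    (hg : ConvexOn ℝ Set.univ g)
    (lam gam : ℝ) (hlam : 0 < lam) (hgam : 0 < gam)
    (glam : EuclideanSpace ℝ (Fin d) → ℝ)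
    (hglam : ∀ x, glam x = ⨅ y, (g y + ‖x - y‖ ^ 2 / (2 * lam)))
    (proxg : EuclideanSpace ℝ (Fin d) → EuclideanSpace ℝ (Fin d))
    (hproxg : ∀ x, IsMinOn (fun y => g y + ‖x - y‖ ^ 2 / (2 * (gam + lam))) Set.univ (proxg x))
    (proxglam : EuclideanSpace ℝ (Fin d) → EuclideanSpace ℝ (Fin d))
    (hproxglam : ∀ x,
      IsMinOn (fun y => glam y + ‖x - y‖ ^ 2 / (2 * gam)) Set.univ (proxglam x))
    (x : EuclideanSpace ℝ (Fin d)) :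
    proxglam x = ((gam + lam)⁻¹) • (gam • proxg x + lam • x) := by
  have hs : 0 < gam + lam := by positivity
  set p := proxg x
  set v := (gam + lam)⁻¹ • (x - p) with hv
  set z := (gam + lam)⁻¹ • (gam • p + lam • x) with hz
  have hx : x = p + (gam + lam) • v := by
    rw [hv, smul_inv_smul₀ hs.ne']
    abel
  have hzp : z = p + lam • v := by
    rw [hz, inv_smul_eq_iff₀ hs.ne', hx]
    module
  have hxz : x = z + gam • v := by
    rw [hx, hzp]
    module
  have hbound : ∀ u y, g p + ⟪v, u - p⟫ - lam * ‖v‖ ^ 2 / 2 ≤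
      g y + ‖u - y‖ ^ 2 / (2 * lam) := by
    intro u y
    have h1 : ⟪v, y - p⟫ ≤ g y - g p := hg.inner_le_sub_of_isMinOn_prox hs (hproxg x) y
    have h2 := neg_mul_sq_norm_le_inner_add_sq_norm_div hlam v (y - u)
    have h3 : ⟪v, y - p⟫ = ⟪v, y - u⟫ + ⟪v, u - p⟫ := by
      rw [← inner_add_right, sub_add_sub_cancel]
    rw [norm_sub_rev] at h2
    linarith
  have hlower : ∀ u, g p + ⟪v, u - p⟫ - lam * ‖v‖ ^ 2 / 2 ≤ glam u := fun u => by
    rw [hglam]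
    exact le_ciInf (hbound u)
  have hupper : glam z ≤ g p + lam * ‖v‖ ^ 2 / 2 := by
    rw [hglam]
    refine (ciInf_le ⟨_, Set.forall_mem_range.2 (hbound z)⟩ p).trans_eq ?_
    rw [hzp, add_sub_cancel_left, norm_smul, mul_pow, Real.norm_eq_abs, sq_abs]
    field_simp
  set q := proxglam x
  have hmin : glam q + ‖x - q‖ ^ 2 / (2 * gam) ≤ glam z + ‖x - z‖ ^ 2 / (2 * gam) :=
    hproxglam x (Set.mem_univ z)
  have hnz : ‖x - z‖ ^ 2 / (2 * gam) = gam * ‖v‖ ^ 2 / 2 := by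
    rw [hxz, add_sub_cancel_left, norm_smul, mul_pow, Real.norm_eq_abs, sq_abs]
    field_simp
  have hnq : ‖x - q‖ ^ 2 / (2 * gam) =
      gam * ‖v‖ ^ 2 / 2 - ⟪v, q - z⟫ + ‖q - z‖ ^ 2 / (2 * gam) := by
    have h : x - q = gam • v - (q - z) := by
      rw [hxz]
      abel
    rw [h, norm_sub_sq_real, real_inner_smul_left, norm_smul, mul_pow, Real.norm_eq_abs, sq_abs]
    field_simp
  have hqp : ⟪v, q - p⟫ = ⟪v, q - z⟫ + lam * ‖v‖ ^ 2 := by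
    have h : q - p = (q - z) + lam • v := by
      rw [hzp]
      abel
    rw [h, inner_add_right, real_inner_smul_right, real_inner_self_eq_norm_sq]
  have hfinal : ‖q - z‖ ^ 2 / (2 * gam) ≤ 0 := by linarith [hlower q]
  have hsq : ‖q - z‖ ^ 2 ≤ 0 := by
    rwa [div_le_iff₀ (by positivity), zero_mul] at hfinal
  exact sub_eq_zero.1 (norm_eq_zero.1 (pow_eq_zero_iff two_ne_zero |>.1
    (le_antisymm hsq (sq_nonneg _))))
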